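/- SG(2k) = 2, and SG(c_m) = 2 for every natural number m ≥ 0, where SG is the Sprague–Grundy function of the game i-Mark({2},{k}) with k ≡ 3 (mod 4). -/

import Mathlib

/-- The minimum excludant of a finite set of naturals. -/
noncomputable def mex (s : Finset ℕ) : ℕ := sInf {x : ℕ | x ∉ s}

/-- Sprague–Grundy function of the game i-Mark({2},{k}):
from a pile of `n ≥ 2` tokens one may subtract `2`,
or replace a positive pile size `n` divisible by `k` by `n / k`. -/
noncomputable def sg (k : ℕ) (hk : 2 ≤ k) (n : ℕ) : ℕ :=
  mex ((if h : 2 ≤ n then {sg k hk (n - 2)} else ∅) ∪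
       (if h : 0 < n ∧ k ∣ n then {sg k hk (n / k)} else ∅))
termination_by n
decreasing_by
  · omega
  · exact Nat.div_lt_self h.1 hk

/-- The sequence `c_0 = 4k`, `c_m = k(c_{m−1} + 2)`. -/
def c (k : ℕ) : ℕ → ℕ
  | 0 => 4 * k
  | m + 1 => k * (c k m + 2)

/-- The sequence `a_0 = k`, `a_m = k(a_{m−1} + 2)`. -/
def a (k : ℕ) : ℕ → ℕ
  | 0 => k
  | m + 1 => k * (a k m + 2)

theorem mex_eq_of_forall_lt {s : Finset ℕ} {v : ℕ} (hv : v ∉ s) (h : ∀ x < v, x ∈ s) :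
    mex s = v := by
  refine le_antisymm (Nat.sInf_le hv) (le_csInf ⟨v, hv⟩ fun x hx => ?_)
  by_contra hlt
  exact hx (h x (not_le.mp hlt))

theorem mex_ne_of_mem {s : Finset ℕ} {v : ℕ} (hv : v ∈ s) : mex s ≠ v := by
  rintro rfl
  obtain ⟨x, hx⟩ := s.exists_notMem
  exact Nat.sInf_mem (s := {x : ℕ | x ∉ s}) ⟨x, hx⟩ hv

section

variable {k : ℕ} (hk : 2 ≤ k)

theorem sg_zero : sg k hk 0 = 0 := by
  rw [sg]
  exact mex_eq_of_forall_lt (by simp) (by simp)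

theorem sg_add_two_of_not_dvd {n : ℕ} (h : ¬ k ∣ n + 2) :
    sg k hk (n + 2) = if sg k hk n = 0 then 1 else 0 := by
  rw [sg]
  split_ifs <;> apply mex_eq_of_forall_lt <;> simp_all [eq_comm]

theorem sg_add_two_of_eq_mul {n j : ℕ} (h : n + 2 = k * j) :
    sg k hk (n + 2) = mex {sg k hk n, sg k hk j} := by
  have hd : (n + 2) / k = j := by
    rw [h]
    exact Nat.mul_div_cancel_left j (by omega)
  have hdvd : k ∣ n + 2 := ⟨j, h⟩
  rw [sg]
  simp only [hd, hdvd]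
  simp

theorem not_dvd_two_mul_add (hodd : k % 2 = 1) {i : ℕ} (hi : 0 < i) (hik : i < k) (q : ℕ) :
    ¬ k ∣ 2 * (k * q) + 2 * i := by
  intro h
  have h2 : k ∣ 2 * i := (Nat.dvd_add_right ⟨2 * q, by ring⟩).mp h
  have hco : Nat.Coprime k 2 := Nat.coprime_two_right.mpr (Nat.odd_iff.mpr hodd)
  exact absurd (Nat.le_of_dvd hi (hco.dvd_of_dvd_mul_left h2)) (by omega)

/-- Between consecutive even multiples of `k` the values alternate. -/
theorem sg_two_mul_add (hodd : k % 2 = 1) (q : ℕ) {i : ℕ} (hik : i + 1 < k) :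
    sg k hk (2 * (k * q) + 2 * (i + 1)) =
      if sg k hk (2 * (k * q)) = 0 then (i + 1) % 2 else i % 2 := by
  induction i with
  | zero =>
    have := sg_add_two_of_not_dvd hk (not_dvd_two_mul_add hodd (i := 1) (by omega) (by omega) q)
    simpa using this
  | succ i ih =>
    have h := sg_add_two_of_not_dvd hk (n := 2 * (k * q) + 2 * (i + 1))
      (not_dvd_two_mul_add hodd (i := i + 2) (by omega) (by omega) q)
    rw [ih (by omega)] at h
    rw [show 2 * (k * q) + 2 * (i + 1 + 1) = 2 * (k * q) + 2 * (i + 1) + 2 by ring, h]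
    split_ifs <;> omega

theorem sg_two_mul_mul_succ (hodd : k % 2 = 1) (q : ℕ) :
    sg k hk (2 * (k * (q + 1))) =
      mex {if sg k hk (2 * (k * q)) = 0 then 0 else 1, sg k hk (2 * (q + 1))} := by
  have h := sg_two_mul_add hk hodd q (i := k - 2) (by omega)
  have e : 2 * (k * (q + 1)) = 2 * (k * q) + 2 * (k - 2 + 1) + 2 := by
    rw [mul_add]
    omega
  rw [e, sg_add_two_of_eq_mul hk (j := 2 * (q + 1)) (by rw [← e]; ring), h,
    show (k - 2 + 1) % 2 = 0 by omega, show (k - 2) % 2 = 1 by omega]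

/-- If `sg` is nonzero at `2kq`, then `sg` at `2k(kq + i)` vanishes for even `0 < i < k`. -/
theorem sg_two_mul_mul_add_eq_zero (hodd : k % 2 = 1) {q : ℕ} (hq : sg k hk (2 * (k * q)) ≠ 0)
    {i : ℕ} (hik : 2 * i + 2 < k) : sg k hk (2 * (k * (k * q + 2 * i + 2))) = 0 := by
  have hne : sg k hk (2 * (k * (k * q + 2 * i + 1))) ≠ 0 := by
    have h := sg_two_mul_add hk hodd q (i := 2 * i) (by omega)
    rw [if_neg hq] at h
    rw [sg_two_mul_mul_succ hk hodd,
      show 2 * (k * q + 2 * i + 1) = 2 * (k * q) + 2 * (2 * i + 1) by ring, h]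
    exact mex_ne_of_mem (by simp)
  have h := sg_two_mul_add hk hodd q (i := 2 * i + 1) (by omega)
  rw [if_neg hq] at h
  rw [show k * q + 2 * i + 2 = k * q + 2 * i + 1 + 1 by ring, sg_two_mul_mul_succ hk hodd,
    if_neg hne, show 2 * (k * q + 2 * i + 1 + 1) = 2 * (k * q) + 2 * (2 * i + 1 + 1) by ring, h]
  exact mex_eq_of_forall_lt (by simp) (by simp)

theorem sg_two_mul_mul_mul_succ (hodd : k % 2 = 1) {q : ℕ} (hq : sg k hk (2 * (k * q)) ≠ 0)
    (hq' : sg k hk (2 * (k * (q + 1))) = 2) :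
    sg k hk (2 * (k * (k * (q + 1)))) = 1 ∧ sg k hk (2 * (k * (k * (q + 1) + 1))) = 2 := by
  have h0 := sg_two_mul_mul_add_eq_zero hk hodd hq (i := (k - 3) / 2) (by omega)
  have e : k * (q + 1) = k * q + 2 * ((k - 3) / 2) + 2 + 1 := by
    rw [mul_add]
    omega
  have h1 : sg k hk (2 * (k * (k * (q + 1)))) = 1 := by
    have h := sg_two_mul_mul_succ hk hodd (k * q + 2 * ((k - 3) / 2) + 2)
    rw [← e, hq', if_pos h0] at h
    rw [h]
    exact mex_eq_of_forall_lt (by simp) (by simp)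
  refine ⟨h1, ?_⟩
  have h2 := sg_two_mul_add hk hodd (q + 1) (i := 0) (by omega)
  rw [hq', if_neg (by omega)] at h2
  rw [sg_two_mul_mul_succ hk hodd, if_neg (by omega), mul_add 2 (k * (q + 1)) 1]
  rw [show 2 * 1 = 2 * (0 + 1) by ring, h2]
  exact mex_eq_of_forall_lt (by simp) (by intro x hx; interval_cases x <;> simp)

theorem sg_two_mul (hodd : k % 2 = 1) : sg k hk (2 * k) = 2 := by
  have h := sg_two_mul_mul_succ hk hodd 0
  have h2 := sg_two_mul_add hk hodd 0 (i := 0) (by omega)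
  simp only [mul_zero, zero_add, mul_one, sg_zero, if_true] at h h2
  rw [h, h2]
  exact mex_eq_of_forall_lt (by simp) (by intro x hx; interval_cases x <;> simp)

theorem sg_four_mul (hodd : k % 2 = 1) : sg k hk (2 * (k * (1 + 1))) = 2 := by
  have h := sg_two_mul_mul_succ hk hodd 1
  have h2 := sg_two_mul_add hk hodd 0 (i := 1) (by omega)
  simp only [mul_zero, zero_add, mul_one, sg_zero, if_true, sg_two_mul hk hodd] at h h2
  rw [h, h2]
  exact mex_eq_of_forall_lt (by simp) (by intro x hx; interval_cases x <;> simp)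

theorem sg_c (hodd : k % 2 = 1) (m : ℕ) :
    ∃ q, c k m = 2 * (k * (q + 1)) ∧ sg k hk (2 * (k * q)) ≠ 0 ∧
      sg k hk (2 * (k * (q + 1))) = 2 := by
  induction m with
  | zero =>
    refine ⟨1, by rw [c]; ring, ?_, sg_four_mul hk hodd⟩
    rw [mul_one, sg_two_mul hk hodd]
    omega
  | succ m ih =>
    obtain ⟨q, hc, hq, hq'⟩ := ih
    obtain ⟨h1, h2⟩ := sg_two_mul_mul_mul_succ hk hodd hq hq'
    exact ⟨k * (q + 1), by rw [c, hc]; ring, by omega, h2⟩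

end

theorem sg_b_and_c (k : ℕ) (hk : k % 4 = 3) :
    sg k (by omega) (2 * k) = 2 ∧ ∀ m : ℕ, sg k (by omega) (c k m) = 2 := by
  have hodd : k % 2 = 1 := by omega
  refine ⟨sg_two_mul _ hodd, fun m => ?_⟩
  obtain ⟨q, hc, -, h⟩ := sg_c (by omega) hodd m
  rw [hc, h]
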